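/- Let M be a 3-pseudomanifold with exactly 8 vertices. Then there exist m ≥ 0 and a sequence of bistellar 1-moves κ_{A_1}, …, κ_{A_m} such that κ_{A_m}(⋯(κ_{A_1}(M))⋯) is a neighbourly 3-pseudomanifold on the same 8 vertices. -/

import Mathlib

/-! Basic framework for finite simplicial complexes, pseudomanifolds and
bistellar moves, following Datta–Nilakantan. A complex is recorded as the
finite set of its faces (nonempty finite subsets of the vertex type). -/

namespace NPM

variable {α β : Type*} [DecidableEq α] [DecidableEq β]

/-- A "complex" datum: a finite family of finite subsets of `α`. -/
abbrev Complex (α : Type*) := Finset (Finset α)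

/-- `K` is a simplicial complex: a nonempty collection of nonempty sets,
closed under passing to nonempty subsets. -/
def IsComplex (K : Complex α) : Prop :=
  K.Nonempty ∧ (∀ σ ∈ K, σ.Nonempty) ∧ ∀ σ ∈ K, ∀ τ ⊆ σ, τ.Nonempty → τ ∈ K

/-- The vertex set of `K`. -/
def verts (K : Complex α) : Finset α := K.sup id

/-- `K` is pure of dimension `d`: every face is contained in a face with
`d+1` vertices. -/
def IsPure (K : Complex α) (d : ℕ) : Prop :=
  ∀ σ ∈ K, ∃ τ ∈ K, σ ⊆ τ ∧ τ.card = d + 1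

/-- The facets ("`d`-faces") of a pure `d`-dimensional complex. -/
def facets (K : Complex α) (d : ℕ) : Complex α := K.filter (fun σ => σ.card = d + 1)

/-- The link of a face `σ` in `K`. -/
def link (K : Complex α) (σ : Finset α) : Complex α :=
  K.filter (fun τ => Disjoint τ σ ∧ σ ∪ τ ∈ K)

/-- The degree of a face: the number of vertices of its link. -/
def degree (K : Complex α) (σ : Finset α) : ℕ := (verts (link K σ)).card

/-- A weak `d`-pseudomanifold: a pure `d`-dimensional complex in which every
`(d-1)`-face (i.e. face with `d` vertices) lies in exactly two facets. -/
def WeakPM (K : Complex α) (d : ℕ) : Prop :=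
  IsComplex K ∧ IsPure K d ∧
    ∀ σ ∈ K, σ.card = d → (K.filter fun τ => σ ⊆ τ ∧ τ.card = d + 1).card = 2

/-- Strong connectedness: any two facets are joined by a chain of facets in
which consecutive facets meet in a `(d-1)`-face. -/
def SConn (K : Complex α) (d : ℕ) : Prop :=
  ∀ σ ∈ facets K d, ∀ τ ∈ facets K d,
    Relation.ReflTransGen
      (fun a b => a ∈ facets K d ∧ b ∈ facets K d ∧ (a ∩ b).card = d) σ τ

/-- A `d`-pseudomanifold: a strongly connected weak `d`-pseudomanifold. -/
def IsPM (K : Complex α) (d : ℕ) : Prop := WeakPM K d ∧ SConn K d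

/-- Connectedness of a complex: the graph of vertices and edges is connected. -/
def Conn (K : Complex α) : Prop :=
  (verts K).Nonempty ∧ ∀ u ∈ verts K, ∀ v ∈ verts K,
    Relation.ReflTransGen (fun a b => a ≠ b ∧ ({a, b} : Finset α) ∈ K) u v

/-- A normal `d`-pseudomanifold: a connected weak `d`-pseudomanifold in which
the link of every face of dimension `≤ d - 2` is connected. -/
def NormalPM (K : Complex α) (d : ℕ) : Prop :=
  WeakPM K d ∧ Conn K ∧ ∀ σ ∈ K, σ.card + 1 ≤ d → Conn (link K σ)

/-- `K` is neighbourly: every pair of vertices forms an edge. -/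
def Neighbourly (K : Complex α) : Prop :=
  ∀ u ∈ verts K, ∀ v ∈ verts K, u ≠ v → ({u, v} : Finset α) ∈ K

/-- Isomorphism of complexes: a map injective on the vertex set carrying the
faces of `K` exactly onto the faces of `L`. -/
def Iso (K : Complex α) (L : Complex β) : Prop :=
  ∃ f : α → β, Set.InjOn f ↑(verts K) ∧ L = K.image (fun σ => σ.image f)

/-- The complex generated by a family of facets: all nonempty subsets. -/
def genCx (F : Finset (Finset α)) : Complex α :=
  F.biUnion fun σ => σ.powerset.filter (fun τ => τ.Nonempty)

/-- The standard sphere on the vertex set `B`: all nonempty proper subsets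
of `B`. -/
def stdSphere (B : Finset α) : Complex α :=
  B.powerset.filter fun τ => τ.Nonempty ∧ τ ≠ B

/-- In a weak `d`-pseudomanifold, a removable `(d-i)`-face `A`: its link is a
standard sphere `S^{i-1}_{i+1}(B)` with `B` not a face.  (For `d = 3`,
`i = 1` gives removable 2-faces and `i = 2` gives removable 1-faces.) -/
def RemovableFace (d i : ℕ) (K : Complex α) (A : Finset α) : Prop :=
  A ∈ K ∧ A.card = d - i + 1 ∧
    ∃ B : Finset α, B.card = i + 1 ∧ B ∉ K ∧ link K A = stdSphere B

/-- The bistellar `i`-move (`0 < i ≤ d`) relation on weak `d`-pseudomanifolds: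
`L` is obtained from `K` by removing a removable `(d-i)`-face `A` with
`link K A = stdSphere B` and inserting the facets `(B ∪ A) \ {v}`, `v ∈ A`. -/
def BMove (d i : ℕ) (K L : Complex α) : Prop :=
  ∃ A B : Finset α, A ∈ K ∧ A.card = d - i + 1 ∧ B.card = i + 1 ∧ B ∉ K ∧
    link K A = stdSphere B ∧
    L = genCx ((facets K d).filter (fun σ => ¬ A ⊆ σ) ∪
          A.image fun v => (B ∪ A).erase v)

/-- The bistellar `0`-move: star a new vertex `w` in a facet `σ`. -/
def BMove0 (d : ℕ) (K L : Complex α) : Prop :=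
  ∃ σ w, σ ∈ K ∧ σ.card = d + 1 ∧ w ∉ verts K ∧
    L = genCx (((facets K d).erase σ) ∪ σ.image fun v => insert w (σ.erase v))

/-- A single bistellar move of any type `0 ≤ i ≤ d`. -/
def BStep (d : ℕ) (K L : Complex α) : Prop :=
  BMove0 d K L ∨ ∃ i, 0 < i ∧ i ≤ d ∧ BMove d i K L

/-- Bistellar equivalence: a finite sequence of bistellar moves. -/
def BEquiv (d : ℕ) : Complex α → Complex α → Prop :=
  Relation.ReflTransGen (BStep d)

/-- A proper bistellar move: a bistellar `i`-move with `0 < i < d`. -/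
def PMove (d : ℕ) (K L : Complex α) : Prop := ∃ i, 0 < i ∧ i < d ∧ BMove d i K L

/-- Proper bistellar equivalence. -/
def PEquiv (d : ℕ) : Complex α → Complex α → Prop :=
  Relation.ReflTransGen (PMove d)

/-- The result of the bistellar move on the face `A` of the weak
`d`-pseudomanifold `K` (deterministic form: `B` is the vertex set of
`link K A`). -/
def kappa (d : ℕ) (K : Complex α) (A : Finset α) : Complex α :=
  genCx ((facets K d).filter (fun σ => ¬ A ⊆ σ) ∪
    A.image fun v => (verts (link K A) ∪ A).erase v)

/-- A cycle: a (finite) 1-pseudomanifold. -/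
def Cycle (K : Complex α) : Prop := IsPM K 1

/-- A combinatorial 2-manifold: a weak 2-pseudomanifold all whose vertex
links are cycles. -/
def Comb2Mfd (K : Complex α) : Prop :=
  WeakPM K 2 ∧ ∀ v, ({v} : Finset α) ∈ K → Cycle (link K {v})

/-- The Euler characteristic `f₀ - f₁ + f₂` of a 2-dimensional complex. -/
def eulerChar (K : Complex α) : ℤ :=
  ((K.filter fun σ => σ.card = 1).card : ℤ) -
    ((K.filter fun σ => σ.card = 2).card : ℤ) +
    ((K.filter fun σ => σ.card = 3).card : ℤ)

/-- A combinatorial 2-sphere: a connected combinatorial 2-manifold with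
Euler characteristic 2. -/
def Comb2Sphere (K : Complex α) : Prop := Comb2Mfd K ∧ Conn K ∧ eulerChar K = 2

/-- A combinatorial 3-manifold: a 3-pseudomanifold all whose vertex links are
combinatorial 2-spheres. -/
def Comb3Mfd (K : Complex α) : Prop :=
  IsPM K 3 ∧ ∀ v, ({v} : Finset α) ∈ K → Comb2Sphere (link K {v})

end NPM


namespace NPM

lemma mem_facets {α : Type*} {K : Complex α} {d : ℕ} {σ : Finset α} :
    σ ∈ facets K d ↔ σ ∈ K ∧ σ.card = d + 1 := by
  simp [facets]

section Basic

variable {α : Type*} [DecidableEq α] {K : Complex α} {d : ℕ}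

lemma mem_verts {x : α} : x ∈ verts K ↔ ∃ σ ∈ K, x ∈ σ := by
  simp [verts, Finset.mem_sup]

lemma mem_genCx {F : Finset (Finset α)} {σ : Finset α} :
    σ ∈ genCx F ↔ σ.Nonempty ∧ ∃ τ ∈ F, σ ⊆ τ := by
  simp only [genCx, Finset.mem_biUnion, Finset.mem_filter, Finset.mem_powerset]
  grind

lemma facets_genCx {F : Finset (Finset α)} (hF : ∀ σ ∈ F, σ.card = d + 1) :
    facets (genCx F) d = F := by
  ext σ
  rw [mem_facets, mem_genCx]
  constructor
  · rintro ⟨⟨-, τ, hτ, hστ⟩, hσ⟩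
    rwa [Finset.eq_of_subset_of_card_le hστ (by rw [hF τ hτ, hσ])]
  · intro hσ
    refine ⟨⟨Finset.card_pos.1 (by rw [hF σ hσ]; omega), σ, hσ, Finset.Subset.refl σ⟩, hF σ hσ⟩

lemma isComplex_genCx {F : Finset (Finset α)} (hF : ∀ σ ∈ F, σ.card = d + 1) (hne : F.Nonempty) :
    IsComplex (genCx F) := by
  refine ⟨?_, fun σ hσ => (mem_genCx.1 hσ).1, fun σ hσ τ hτ hne => ?_⟩
  · obtain ⟨σ, hσ⟩ := hne
    exact ⟨σ, mem_genCx.2 ⟨Finset.card_pos.1 (by rw [hF σ hσ]; omega), σ, hσ, Finset.Subset.refl σ⟩⟩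
  · obtain ⟨-, ρ, hρ, hσρ⟩ := mem_genCx.1 hσ
    exact mem_genCx.2 ⟨hne, ρ, hρ, hτ.trans hσρ⟩

lemma isPure_genCx {F : Finset (Finset α)} (hF : ∀ σ ∈ F, σ.card = d + 1) :
    IsPure (genCx F) d := by
  intro σ hσ
  obtain ⟨-, τ, hτ, hστ⟩ := mem_genCx.1 hσ
  rw [← facets_genCx hF, mem_facets] at hτ
  exact ⟨τ, hτ.1, hστ, hτ.2⟩

lemma filter_ridge (σ : Finset α) :
    (K.filter fun τ => σ ⊆ τ ∧ τ.card = d + 1) = (facets K d).filter (σ ⊆ ·) := by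
  ext τ
  simp only [Finset.mem_filter, mem_facets]
  tauto

lemma WeakPM.card_ridge (hK : WeakPM K d) {σ : Finset α} (hσ : σ ∈ K) (hd : σ.card = d) :
    ((facets K d).filter (σ ⊆ ·)).card = 2 := by
  rw [← filter_ridge, hK.2.2 σ hσ hd]

lemma WeakPM.mem_of_subset (hK : WeakPM K d) {σ τ : Finset α} (hσ : σ ∈ K) (hτσ : τ ⊆ σ)
    (hτ : τ.Nonempty) : τ ∈ K :=
  hK.1.2.2 σ hσ τ hτσ hτ

lemma card_of_insert_mem_facets {σ : Finset α} {x : α} (hx : x ∉ σ)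
    (h : insert x σ ∈ facets K d) : σ.card = d := by
  have := (mem_facets.1 h).2
  rw [Finset.card_insert_of_notMem hx] at this
  omega

lemma WeakPM.ridge_mem (hK : WeakPM K d) (hd : d ≠ 0) {σ : Finset α} {x : α} (hx : x ∉ σ)
    (h : insert x σ ∈ facets K d) : σ ∈ K := by
  refine hK.mem_of_subset (mem_facets.1 h).1 (Finset.subset_insert x σ) (Finset.card_pos.1 ?_)
  rw [card_of_insert_mem_facets hx h]
  omega

/-- The two facets through a ridge are the only ones. -/
lemma WeakPM.eq_or_eq (hK : WeakPM K d) (hd : d ≠ 0) {σ τ : Finset α} {x y : α} (hx : x ∉ σ)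
    (hxy : x ≠ y) (hxσ : insert x σ ∈ facets K d) (hyσ : insert y σ ∈ facets K d)
    (hτ : τ ∈ facets K d) (hστ : σ ⊆ τ) : τ = insert x σ ∨ τ = insert y σ := by
  have hne : insert x σ ≠ insert y σ := by
    intro h
    have : x ∈ insert y σ := h ▸ Finset.mem_insert_self x σ
    grind
  have hsub : {insert x σ, insert y σ} ⊆ (facets K d).filter (σ ⊆ ·) := by
    intro ρ hρ
    simp only [Finset.mem_insert, Finset.mem_singleton] at hρ
    rcases hρ with rfl | rfl <;> simp [hxσ, hyσ]
  have := Finset.eq_of_subset_of_card_le hsub (by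
    rw [hK.card_ridge (hK.ridge_mem hd hx hxσ) (card_of_insert_mem_facets hx hxσ),
      Finset.card_pair hne])
  have hmem : τ ∈ (facets K d).filter (σ ⊆ ·) := by simp [hτ, hστ]
  rw [← this] at hmem
  simpa using hmem

lemma WeakPM.not_three (hK : WeakPM K d) (hd : d ≠ 0) {σ : Finset α} {x y z : α} (hx : x ∉ σ)
    (hz : z ∉ σ) (hxy : x ≠ y) (hxz : x ≠ z) (hyz : y ≠ z)
    (hxσ : insert x σ ∈ facets K d) (hyσ : insert y σ ∈ facets K d)
    (hzσ : insert z σ ∈ facets K d) : False := by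
  have hmem := Finset.mem_insert_self z σ
  rcases hK.eq_or_eq hd hx hxy hxσ hyσ hzσ (Finset.subset_insert z σ) with h | h <;>
    rw [h] at hmem <;> grind

lemma exists_insert_eq {σ τ : Finset α} (hστ : σ ⊆ τ) (h : τ.card = σ.card + 1) :
    ∃ y, y ∉ σ ∧ insert y σ = τ := by
  obtain ⟨y, hy⟩ := Finset.card_eq_one.1 (show (τ \ σ).card = 1 by
    rw [Finset.card_sdiff_of_subset hστ]; omega)
  have hmem : y ∈ τ \ σ := by simp [hy]
  refine ⟨y, (Finset.mem_sdiff.1 hmem).2, ?_⟩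
  rw [Finset.insert_eq, ← hy, Finset.sdiff_union_of_subset hστ]

lemma WeakPM.exists_other (hK : WeakPM K d) (hd : d ≠ 0) {σ : Finset α} {x : α} (hx : x ∉ σ)
    (hxσ : insert x σ ∈ facets K d) : ∃ y, y ∉ σ ∧ y ≠ x ∧ insert y σ ∈ facets K d := by
  have hσ := card_of_insert_mem_facets hx hxσ
  have h2 := hK.card_ridge (hK.ridge_mem hd hx hxσ) hσ
  obtain ⟨τ, hτ, hne⟩ := Finset.exists_mem_ne
    (show 1 < ((facets K d).filter (σ ⊆ ·)).card by omega) (insert x σ)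
  rw [Finset.mem_filter] at hτ
  obtain ⟨y, hy, rfl⟩ := exists_insert_eq hτ.2 (by rw [(mem_facets.1 hτ.1).2, hσ])
  exact ⟨y, hy, fun h => hne (h ▸ rfl), hτ.1⟩

lemma WeakPM.exists_facet (hK : WeakPM K d) {σ : Finset α} (hσ : σ ∈ K) :
    ∃ τ ∈ facets K d, σ ⊆ τ := by
  obtain ⟨τ, hτ, hστ, hd⟩ := hK.2.1 σ hσ
  exact ⟨τ, mem_facets.2 ⟨hτ, hd⟩, hστ⟩

lemma WeakPM.singleton_mem (hK : WeakPM K d) {x : α} (hx : x ∈ verts K) : {x} ∈ K := by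
  obtain ⟨σ, hσ, hxσ⟩ := mem_verts.1 hx
  exact hK.mem_of_subset hσ (by simpa using hxσ) (by simp)

end Basic

section Move

variable {α : Type*} [DecidableEq α] {K : Complex α}

/-- The facets after the bistellar 1-move on the 2-face `A` with link `{u, v}`. -/
def moveFacets (K : Complex α) (A : Finset α) (u v : α) : Finset (Finset α) :=
  (facets K 3).filter (fun σ => ¬ A ⊆ σ) ∪ A.image fun a => ({u, v} ∪ A).erase a

/-- The bistellar 1-move on the 2-face `A` with link `{u, v}`. -/
def move (K : Complex α) (A : Finset α) (u v : α) : Complex α := genCx (moveFacets K A u v)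

/-- The 2-face `A` has link `{u, v}` and `uv` is not an edge. -/
structure Movable (K : Complex α) (A : Finset α) (u v : α) : Prop where
  left_notMem : u ∉ A
  right_notMem : v ∉ A
  ne : u ≠ v
  left_mem : insert u A ∈ facets K 3
  right_mem : insert v A ∈ facets K 3
  edge_notMem : {u, v} ∉ K

lemma mem_moveFacets {A τ : Finset α} {u v : α} :
    τ ∈ moveFacets K A u v ↔
      (τ ∈ facets K 3 ∧ ¬ A ⊆ τ) ∨ ∃ a ∈ A, ({u, v} ∪ A).erase a = τ := by
  simp [moveFacets]

variable {A : Finset α} {u v : α}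

lemma Movable.symm (h : Movable K A u v) : Movable K A v u :=
  ⟨h.2, h.1, h.3.symm, h.5, h.4, Finset.pair_comm u v ▸ h.6⟩

lemma moveFacets_comm : moveFacets K A u v = moveFacets K A v u := by
  simp [moveFacets, Finset.pair_comm]

lemma Movable.card (h : Movable K A u v) : A.card = 3 :=
  card_of_insert_mem_facets h.1 h.4

lemma Movable.card_union (h : Movable K A u v) : ({u, v} ∪ A : Finset α).card = 5 := by
  have h1 := h.left_notMem
  have h2 := h.right_notMem
  rw [Finset.card_union_of_disjoint (by simp [Finset.disjoint_left, h1, h2]),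
    Finset.card_pair h.ne, h.card]

lemma Movable.card_moveFacets (h : Movable K A u v) : ∀ σ ∈ moveFacets K A u v, σ.card = 3 + 1 := by
  intro σ hσ
  rcases mem_moveFacets.1 hσ with ⟨hσ, -⟩ | ⟨a, ha, rfl⟩
  · exact (mem_facets.1 hσ).2
  · rw [Finset.card_erase_of_mem (by simp [ha]), h.card_union]

lemma Movable.facets_move (h : Movable K A u v) : facets (move K A u v) 3 = moveFacets K A u v :=
  facets_genCx h.card_moveFacets

lemma Movable.notMem_of_pair (h : Movable K A u v) (hK : WeakPM K 3) {σ : Finset α} (hu : u ∈ σ)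
    (hv : v ∈ σ) : σ ∉ K :=
  fun hσ => h.edge_notMem (hK.mem_of_subset hσ (by grind) (by simp))

lemma Movable.eq_or_eq (h : Movable K A u v) (hK : WeakPM K 3) {τ : Finset α} (hτ : τ ∈ facets K 3)
    (hA : A ⊆ τ) : τ = insert u A ∨ τ = insert v A :=
  hK.eq_or_eq three_ne_zero h.1 h.3 h.4 h.5 hτ hA

lemma Movable.bMove (h : Movable K A u v) (hK : WeakPM K 3) : BMove 3 1 K (move K A u v) := by
  refine ⟨A, {u, v}, hK.ridge_mem three_ne_zero h.1 h.4, h.card, Finset.card_pair h.ne,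
    h.edge_notMem, ?_, rfl⟩
  have huA := h.left_notMem
  have hvA := h.right_notMem
  have huv := h.ne
  have single : ∀ x ∉ A, insert x A ∈ facets K 3 → {x} ∈ link K A := by
    intro x hx hxA
    simp only [link, Finset.mem_filter, Finset.disjoint_singleton_left]
    refine ⟨hK.mem_of_subset (mem_facets.1 hxA).1 (by simp) (by simp), hx, ?_⟩
    rw [Finset.union_comm, ← Finset.insert_eq]
    exact (mem_facets.1 hxA).1
  ext τ
  constructor
  · intro hτ
    simp only [link, Finset.mem_filter] at hτ
    obtain ⟨hτK, hdis, hun⟩ := hτ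
    obtain ⟨ρ, hρ, hsub⟩ := hK.exists_facet hun
    have hne := hK.1.2.1 τ hτK
    have hρ' : τ ⊆ {u} ∨ τ ⊆ {v} := by
      rw [Finset.disjoint_left] at hdis
      rcases h.eq_or_eq hK hρ (Finset.subset_union_left.trans hsub) with rfl | rfl
      · left; intro x hx
        have := hsub (Finset.mem_union_right A hx)
        grind
      · right; intro x hx
        have := hsub (Finset.mem_union_right A hx)
        grind
    simp only [stdSphere, Finset.mem_filter, Finset.mem_powerset]
    refine ⟨?_, hne, ?_⟩
    · rcases hρ' with h' | h' <;> exact h'.trans (by simp)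
    · rintro rfl
      rcases hρ' with h' | h'
      · exact huv (Finset.mem_singleton.1 (h' (by simp : v ∈ {u, v}))).symm
      · exact huv (Finset.mem_singleton.1 (h' (by simp : u ∈ {u, v})))
  · intro hτ
    simp only [stdSphere, Finset.mem_filter, Finset.mem_powerset] at hτ
    obtain ⟨hsub, hne, hne'⟩ := hτ
    have hcard : τ.card = 1 := by
      have h1 := Finset.card_pos.2 hne
      have h2 := Finset.card_lt_card (Finset.ssubset_iff_subset_ne.2 ⟨hsub, hne'⟩)
      rw [Finset.card_pair huv] at h2
      omega
    obtain ⟨x, rfl⟩ := Finset.card_eq_one.1 hcard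
    have : x = u ∨ x = v := by simpa using hsub
    rcases this with rfl | rfl
    · exact single x huA h.4
    · exact single x hvA h.5

lemma Movable.verts_move (h : Movable K A u v) (hK : WeakPM K 3) :
    verts (move K A u v) = verts K := by
  ext x
  simp only [mem_verts]
  constructor
  · rintro ⟨σ, hσ, hx⟩
    obtain ⟨-, τ, hτ, hστ⟩ := mem_genCx.1 hσ
    rcases mem_moveFacets.1 hτ with ⟨hτ, -⟩ | ⟨a, ha, rfl⟩
    · exact ⟨τ, (mem_facets.1 hτ).1, hστ hx⟩
    · have hu := (mem_facets.1 h.left_mem).1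
      have hv := (mem_facets.1 h.right_mem).1
      have := hστ hx
      by_cases hxv : x = v
      · exact ⟨_, hv, by simp [hxv]⟩
      · exact ⟨_, hu, by grind⟩
  · rintro ⟨σ, hσ, hx⟩
    obtain ⟨τ, hτ, hστ⟩ := hK.exists_facet hσ
    by_cases hA : A ⊆ τ
    · have hxN : x ∈ {u, v} ∪ A := by
        have := hστ hx
        rcases h.eq_or_eq hK hτ hA with rfl | rfl <;> grind
      obtain ⟨a, ha, hax⟩ := Finset.exists_mem_ne (by rw [h.card]; omega) x
      have hmem : x ∈ ({u, v} ∪ A).erase a := Finset.mem_erase.2 ⟨hax.symm, hxN⟩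
      exact ⟨_, mem_genCx.2 ⟨⟨x, hmem⟩, _, mem_moveFacets.2 (.inr ⟨a, ha, rfl⟩),
        Finset.Subset.refl _⟩, hmem⟩
    · exact ⟨τ, mem_genCx.2 ⟨⟨x, hστ hx⟩, τ, mem_moveFacets.2 (.inl ⟨hτ, hA⟩),
        Finset.Subset.refl _⟩, hστ hx⟩

lemma Movable.mem_move_of_card_le (h : Movable K A u v) (hK : WeakPM K 3) {σ : Finset α}
    (hσ : σ ∈ K) (h2 : σ.card ≤ 2) : σ ∈ move K A u v := by
  refine mem_genCx.2 ⟨hK.1.2.1 σ hσ, ?_⟩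
  obtain ⟨τ, hτ, hστ⟩ := hK.exists_facet hσ
  by_cases hA : A ⊆ τ
  · obtain ⟨a, ha, haσ⟩ := Finset.exists_mem_notMem_of_card_lt_card
      (show σ.card < A.card by rw [h.card]; omega)
    refine ⟨_, mem_moveFacets.2 (.inr ⟨a, ha, rfl⟩), fun x hx => ?_⟩
    have := hστ hx
    rcases h.eq_or_eq hK hτ hA with rfl | rfl <;> grind
  · exact ⟨τ, mem_moveFacets.2 (.inl ⟨hτ, hA⟩), hστ⟩

lemma Movable.edge_mem_move (h : Movable K A u v) : {u, v} ∈ move K A u v := by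
  have hu := h.left_notMem
  have hv := h.right_notMem
  obtain ⟨a, ha⟩ := Finset.card_pos.1 (show 0 < A.card by rw [h.card]; omega)
  exact mem_genCx.2 ⟨by simp, _, mem_moveFacets.2 (.inr ⟨a, ha, rfl⟩), by grind⟩

/-- The ridge count after a move, for a ridge containing exactly one end of the new edge. -/
lemma Movable.card_ridge_aux (h : Movable K A u v) (hK : WeakPM K 3) {σ : Finset α}
    (hσ : σ ⊆ {u, v} ∪ A) (h3 : σ.card = 3) (huσ : u ∈ σ) (hvσ : v ∉ σ) :
    ((moveFacets K A u v).filter (σ ⊆ ·)).card = 2 := by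
  have hu := h.left_notMem
  have hv := h.right_notMem
  have hsub : σ ⊆ insert u A := by grind
  have hσK : σ ∈ K := hK.mem_of_subset (mem_facets.1 h.left_mem).1 hsub ⟨u, huσ⟩
  obtain ⟨a, haσ, ha⟩ := exists_insert_eq hsub (by rw [Finset.card_insert_of_notMem hu, h.card, h3])
  have haA : a ∈ A := by
    have : a ∈ insert u A := ha ▸ Finset.mem_insert_self a σ
    grind
  have hfil : (moveFacets K A u v).filter (σ ⊆ ·) =
      insert (({u, v} ∪ A).erase a) (((facets K 3).filter (σ ⊆ ·)).erase (insert u A)) := by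
    ext τ
    simp only [Finset.mem_filter, mem_moveFacets, Finset.mem_insert, Finset.mem_erase]
    constructor
    · rintro ⟨⟨hτ, hA⟩ | ⟨b, hb, rfl⟩, hτσ⟩
      · exact .inr ⟨by rintro rfl; exact hA (Finset.subset_insert u A), hτ, hτσ⟩
      · left
        have : b ∉ σ := fun hbσ => by simpa using hτσ hbσ
        have : b ∈ insert a σ := ha ▸ Finset.mem_insert_of_mem hb
        grind
    · rintro (rfl | ⟨hne, hτ, hτσ⟩)
      · refine ⟨.inr ⟨a, haA, rfl⟩, fun x hx => ?_⟩
        have := hσ hx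
        grind
      · refine ⟨.inl ⟨hτ, fun hA => ?_⟩, hτσ⟩
        have := hτσ huσ
        rcases h.eq_or_eq hK hτ hA with rfl | rfl
        · exact hne rfl
        · have := h.ne
          grind
  rw [hfil, Finset.card_insert_of_notMem, Finset.card_erase_of_mem, hK.card_ridge hσK h3]
  · simpa using ⟨h.left_mem, hsub⟩
  · intro hmem
    have hmem := (Finset.mem_filter.1 (Finset.mem_of_mem_erase hmem)).1
    exact h.notMem_of_pair hK (by grind) (by grind) (mem_facets.1 hmem).1

lemma Movable.weakPM_move (h : Movable K A u v) (hK : WeakPM K 3) : WeakPM (move K A u v) 3 := by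
  have hu := h.left_notMem
  have hv := h.right_notMem
  have huv := h.ne
  have hne : (moveFacets K A u v).Nonempty := by
    obtain ⟨a, ha⟩ := Finset.card_pos.1 (show 0 < A.card by rw [h.card]; omega)
    exact ⟨_, mem_moveFacets.2 (.inr ⟨a, ha, rfl⟩)⟩
  refine ⟨isComplex_genCx h.card_moveFacets hne, isPure_genCx h.card_moveFacets, fun σ hσ h3 => ?_⟩
  rw [filter_ridge, h.facets_move]
  obtain ⟨-, ρ, hρ, hσρ⟩ := mem_genCx.1 hσ
  by_cases hN : σ ⊆ {u, v} ∪ A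
  · by_cases huσ : u ∈ σ <;> by_cases hvσ : v ∈ σ
    · have hfil : (moveFacets K A u v).filter (σ ⊆ ·) =
          (A \ σ).image fun a => ({u, v} ∪ A).erase a := by
        ext τ
        simp only [Finset.mem_filter, mem_moveFacets, Finset.mem_image, Finset.mem_sdiff]
        constructor
        · rintro ⟨⟨hτ, hA⟩ | ⟨b, hb, rfl⟩, hτσ⟩
          · exact absurd (mem_facets.1 hτ).1 (h.notMem_of_pair hK (hτσ huσ) (hτσ hvσ))
          · exact ⟨b, ⟨hb, fun hbσ => by simpa using hτσ hbσ⟩, rfl⟩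
        · rintro ⟨a, ⟨haA, haσ⟩, rfl⟩
          refine ⟨.inr ⟨a, haA, rfl⟩, fun x hx => ?_⟩
          have := hN hx
          grind
      have hsplit : σ = {u, v} ∪ (A ∩ σ) := by grind
      have hint : (A ∩ σ).card = 1 := by
        have := h3
        rw [hsplit, Finset.card_union_of_disjoint (by simp [Finset.disjoint_left, hu, hv]),
          Finset.card_pair huv] at this
        omega
      rw [hfil, Finset.card_image_of_injOn]
      · have := Finset.card_sdiff_add_card_inter A σ
        rw [h.card] at this
        omega
      · intro a ha b hb hab
        simp only [Finset.coe_sdiff, Set.mem_sdiff, Finset.mem_coe] at ha hb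
        by_contra hne
        have : a ∈ ({u, v} ∪ A).erase b := Finset.mem_erase.2 ⟨hne, by simp [ha.1]⟩
        have hab' : ({u, v} ∪ A).erase a = ({u, v} ∪ A).erase b := hab
        rw [← hab'] at this
        simp at this
    · exact h.card_ridge_aux hK hN h3 huσ hvσ
    · rw [moveFacets_comm]
      exact h.symm.card_ridge_aux hK (Finset.pair_comm u v ▸ hN) h3 hvσ huσ
    · have hσA : σ = A := Finset.eq_of_subset_of_card_le (by grind) (by rw [h.card, h3])
      subst hσA
      rcases mem_moveFacets.1 hρ with ⟨-, hA⟩ | ⟨a, ha, rfl⟩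
      · exact absurd hσρ hA
      · have := hσρ ha
        grind
  · have hfil : (moveFacets K A u v).filter (σ ⊆ ·) = (facets K 3).filter (σ ⊆ ·) := by
      ext τ
      simp only [Finset.mem_filter, mem_moveFacets]
      constructor
      · rintro ⟨⟨hτ, hA⟩ | ⟨b, hb, rfl⟩, hτσ⟩
        · exact ⟨hτ, hτσ⟩
        · exact absurd (hτσ.trans (Finset.erase_subset _ _)) hN
      · rintro ⟨hτ, hτσ⟩
        refine ⟨.inl ⟨hτ, fun hA => hN (hτσ.trans ?_)⟩, hτσ⟩
        rcases h.eq_or_eq hK hτ hA with rfl | rfl <;> grind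
    have hσK : σ ∈ K := by
      rcases mem_moveFacets.1 hρ with ⟨hρ, -⟩ | ⟨a, ha, rfl⟩
      · exact hK.mem_of_subset (mem_facets.1 hρ).1 hσρ (Finset.card_pos.1 (by omega))
      · exact absurd (hσρ.trans (Finset.erase_subset _ _)) hN
    rw [hfil, hK.card_ridge hσK h3]

lemma card_inter_eq {σ τ ρ : Finset α} {d : ℕ} (hσ : σ.card = d + 1) (hτ : τ.card = d + 1)
    (hne : σ ≠ τ) (hρ : ρ.card = d) (hρσ : ρ ⊆ σ) (hρτ : ρ ⊆ τ) : (σ ∩ τ).card = d := by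
  have h1 := Finset.card_le_card (Finset.subset_inter hρσ hρτ)
  have h2 : (σ ∩ τ).card < σ.card := by
    refine Finset.card_lt_card (Finset.ssubset_iff_subset_ne.2 ⟨Finset.inter_subset_left, fun h => ?_⟩)
    exact hne (Finset.eq_of_subset_of_card_le (Finset.inter_eq_left.1 h) (by omega))
  omega

lemma Movable.sConn_move (h : Movable K A u v) (hK : IsPM K 3) : SConn (move K A u v) 3 := by
  have hu := h.left_notMem
  have hv := h.right_notMem
  have huv := h.ne
  intro σ₁ hσ₁ σ₂ hσ₂
  rw [h.facets_move] at hσ₁ hσ₂ ⊢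
  set R : Finset α → Finset α → Prop := fun a b =>
    a ∈ moveFacets K A u v ∧ b ∈ moveFacets K A u v ∧ (a ∩ b).card = 3 with hR
  have hRsymm : Std.Symm R := ⟨fun a b hab => ⟨hab.2.1, hab.1, Finset.inter_comm a b ▸ hab.2.2⟩⟩
  have hcard := h.card_moveFacets
  let ν : α → Finset α := fun a => ({u, v} ∪ A).erase a
  have hν : ∀ a ∈ A, ν a ∈ moveFacets K A u v := fun a ha => mem_moveFacets.2 (.inr ⟨a, ha, rfl⟩)
  obtain ⟨a₀, ha₀⟩ := Finset.card_pos.1 (show 0 < A.card by rw [h.card]; omega)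
  have hνν : ∀ a ∈ A, ∀ b ∈ A, Relation.ReflTransGen R (ν a) (ν b) := by
    intro a ha b hb
    rcases eq_or_ne a b with rfl | hab
    · exact .refl
    · refine .single ⟨hν a ha, hν b hb, ?_⟩
      have heq : ν a ∩ ν b = (({u, v} ∪ A).erase a).erase b := by grind
      rw [heq, Finset.card_erase_of_mem (by grind), Finset.card_erase_of_mem (by grind),
        h.card_union]
  let φ : Finset α → Finset α := fun σ => if A ⊆ σ then ν a₀ else σ
  have hold : ∀ σ ∈ facets K 3, ∀ τ ∈ facets K 3, (σ ∩ τ).card = 3 → ¬ A ⊆ σ → A ⊆ τ →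
      Relation.ReflTransGen R σ (ν a₀) := by
    intro σ hσ τ hτ hστ hAσ hAτ
    obtain ⟨a, haA, haσ⟩ := Finset.not_subset.1 hAσ
    refine .trans (.single ⟨mem_moveFacets.2 (.inl ⟨hσ, hAσ⟩), hν a haA, ?_⟩) (hνν a haA a₀ ha₀)
    refine card_inter_eq (mem_facets.1 hσ).2 (hcard _ (hν a haA)) ?_ hστ
      Finset.inter_subset_left ?_
    · rintro rfl
      exact h.notMem_of_pair hK.1 (by grind) (by grind) (mem_facets.1 hσ).1
    · intro x hx
      rw [Finset.mem_inter] at hx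
      refine Finset.mem_erase.2 ⟨fun hxa => haσ (hxa ▸ hx.1), ?_⟩
      rcases h.eq_or_eq hK.1 hτ hAτ with rfl | rfl <;> grind
  have hφ : ∀ σ τ, Relation.ReflTransGen
      (fun a b => a ∈ facets K 3 ∧ b ∈ facets K 3 ∧ (a ∩ b).card = 3) σ τ →
      Relation.ReflTransGen R (φ σ) (φ τ) := by
    intro σ τ hστ
    refine Relation.ReflTransGen.lift' φ ?_ _ _ hστ
    rintro a b ⟨ha, hb, hab⟩
    change Relation.ReflTransGen R (φ a) (φ b)
    by_cases hAa : A ⊆ a <;> by_cases hAb : A ⊆ b <;> simp only [φ, hAa, hAb, if_true, if_false]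
    · exact .refl
    · exact symm_of _ (hold b hb a ha (Finset.inter_comm a b ▸ hab) hAb hAa)
    · exact hold a ha b hb hab hAa hAb
    · exact .single ⟨mem_moveFacets.2 (.inl ⟨ha, hAa⟩), mem_moveFacets.2 (.inl ⟨hb, hAb⟩), hab⟩
  have hrep : ∀ σ ∈ moveFacets K A u v, ∃ τ ∈ facets K 3, Relation.ReflTransGen R σ (φ τ) := by
    intro σ hσ
    rcases mem_moveFacets.1 hσ with ⟨hσ, hA⟩ | ⟨a, ha, rfl⟩
    · exact ⟨σ, hσ, by simp only [φ, hA, if_false]; exact .refl⟩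
    · refine ⟨_, h.left_mem, ?_⟩
      simp only [φ, Finset.subset_insert, if_true]
      exact hνν a ha a₀ ha₀
  obtain ⟨τ₁, hτ₁, h₁⟩ := hrep σ₁ hσ₁
  obtain ⟨τ₂, hτ₂, h₂⟩ := hrep σ₂ hσ₂
  exact (h₁.trans (hφ _ _ (hK.2 τ₁ hτ₁ τ₂ hτ₂))).trans (symm_of _ h₂)

lemma Movable.isPM_move (h : Movable K A u v) (hK : IsPM K 3) : IsPM (move K A u v) 3 :=
  ⟨h.weakPM_move hK.1, h.sConn_move hK⟩

end Move

section Refutation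

/-- The clauses satisfied by the facets of an 8-vertex 3-pseudomanifold in which no bistellar
1-move exists although `67` is not an edge. The vertices are `0, …, 7` and a set of vertices is
coded by its bit mask. -/
structure Stuck (P : ℕ → Prop) : Prop where
  three : ∀ t x y z, x < 8 → y < 8 → z < 8 → t.testBit x = false → t.testBit y = false →
    t.testBit z = false → x ≠ y → x ≠ z → y ≠ z → P (t ||| 2 ^ x) → P (t ||| 2 ^ y) →
    ¬ P (t ||| 2 ^ z)
  one : ∀ t x, x < 8 → t.testBit x = false → P (t ||| 2 ^ x) →
    ∃ y < 8, t.testBit y = false ∧ y ≠ x ∧ P (t ||| 2 ^ y)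
  edge : ∀ t x y, x < 8 → y < 8 → t.testBit x = false → t.testBit y = false → x ≠ y →
    P (t ||| 2 ^ x) → P (t ||| 2 ^ y) →
    ∃ q < 8, ∃ p < q, p ≠ x ∧ p ≠ y ∧ q ≠ x ∧ q ≠ y ∧ P (2 ^ x ||| 2 ^ y ||| 2 ^ p ||| 2 ^ q)
  nonedge : ∀ k, k.testBit 6 → k.testBit 7 → ¬ P k
  seven : ∃ r < 7, ∃ q < r, ∃ p < q, P (2 ^ 7 ||| 2 ^ p ||| 2 ^ q ||| 2 ^ r)

/-- A decision tree whose leaves name violated clauses of `Stuck`. -/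
inductive Refutation
  | three (t x y z : ℕ)
  | one (t x : ℕ)
  | edge (t x y : ℕ)
  | seven
  | split (k : ℕ) (l r : Refutation)

/-- `k` is known not to be a facet. -/
def known (F : List ℕ) (k : ℕ) : Bool := F.contains k || (k.testBit 6 && k.testBit 7)

/-- Checks a decision tree, given the facets `T` and the non-facets `F`. -/
def Refutation.check : Refutation → List ℕ → List ℕ → Bool
  | .three t x y z, T, _ =>
    decide (x < 8) && decide (y < 8) && decide (z < 8) && !t.testBit x && !t.testBit y &&
      !t.testBit z && decide (x ≠ y) && decide (x ≠ z) && decide (y ≠ z) &&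
      T.contains (t ||| 2 ^ x) && T.contains (t ||| 2 ^ y) && T.contains (t ||| 2 ^ z)
  | .one t x, T, F =>
    decide (x < 8) && !t.testBit x && T.contains (t ||| 2 ^ x) &&
      (List.range 8).all fun y => t.testBit y || decide (y = x) || known F (t ||| 2 ^ y)
  | .edge t x y, T, F =>
    decide (x < 8) && decide (y < 8) && !t.testBit x && !t.testBit y && decide (x ≠ y) &&
      T.contains (t ||| 2 ^ x) && T.contains (t ||| 2 ^ y) &&
      (List.range 8).all fun q => (List.range q).all fun p =>
        decide (p = x) || decide (p = y) || decide (q = x) || decide (q = y) ||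
          known F (2 ^ x ||| 2 ^ y ||| 2 ^ p ||| 2 ^ q)
  | .seven, _, F =>
    (List.range 7).all fun r => (List.range r).all fun q => (List.range q).all fun p =>
      known F (2 ^ 7 ||| 2 ^ p ||| 2 ^ q ||| 2 ^ r)
  | .split k l r, T, F => l.check (k :: T) F && r.check T (k :: F)

variable {P : ℕ → Prop}

lemma Stuck.not_of_known (hP : Stuck P) {F : List ℕ} (hF : ∀ k ∈ F, ¬ P k) {k : ℕ}
    (h : known F k = true) : ¬ P k := by
  simp only [known, Bool.or_eq_true, List.contains_iff_mem, Bool.and_eq_true] at h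
  exact h.elim (hF k) fun h => hP.nonedge k h.1 h.2

lemma Stuck.false_of_check (hP : Stuck P) (c : Refutation) {T F : List ℕ} (hT : ∀ k ∈ T, P k)
    (hF : ∀ k ∈ F, ¬ P k) (h : c.check T F = true) : False := by
  induction c generalizing T F with
  | three t x y z =>
    simp only [Refutation.check, Bool.and_eq_true, decide_eq_true_eq, List.contains_iff_mem,
      Bool.not_eq_true'] at h
    obtain ⟨⟨⟨⟨⟨⟨⟨⟨⟨⟨⟨hx, hy⟩, hz⟩, htx⟩, hty⟩, htz⟩, hxy⟩, hxz⟩, hyz⟩, h1⟩, h2⟩, h3⟩ := h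
    exact hP.three t x y z hx hy hz htx hty htz hxy hxz hyz (hT _ h1) (hT _ h2) (hT _ h3)
  | one t x =>
    simp only [Refutation.check, Bool.and_eq_true, decide_eq_true_eq, List.contains_iff_mem,
      Bool.not_eq_true', List.all_eq_true, List.mem_range, Bool.or_eq_true] at h
    obtain ⟨⟨⟨hx, htx⟩, h1⟩, hall⟩ := h
    obtain ⟨y, hy, hty, hyx, hPy⟩ := hP.one t x hx htx (hT _ h1)
    rcases hall y hy with (h | h) | h
    · simp [hty] at h
    · exact hyx h
    · exact hP.not_of_known hF h hPy
  | edge t x y =>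
    simp only [Refutation.check, Bool.and_eq_true, decide_eq_true_eq, List.contains_iff_mem,
      Bool.not_eq_true', List.all_eq_true, List.mem_range, Bool.or_eq_true] at h
    obtain ⟨⟨⟨⟨⟨⟨⟨hx, hy⟩, htx⟩, hty⟩, hxy⟩, h1⟩, h2⟩, hall⟩ := h
    obtain ⟨q, hq, p, hp, hpx, hpy, hqx, hqy, hPk⟩ :=
      hP.edge t x y hx hy htx hty hxy (hT _ h1) (hT _ h2)
    rcases hall q hq p hp with (((h | h) | h) | h) | h
    · exact hpx h
    · exact hpy h
    · exact hqx h
    · exact hqy h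
    · exact hP.not_of_known hF h hPk
  | seven =>
    simp only [Refutation.check, List.all_eq_true, List.mem_range] at h
    obtain ⟨r, hr, q, hq, p, hp, hPk⟩ := hP.seven
    exact hP.not_of_known hF (h r hr q hq p hp) hPk
  | split k l r ihl ihr =>
    simp only [Refutation.check, Bool.and_eq_true] at h
    by_cases hk : P k
    · exact ihl (by simpa [hk] using hT) hF h.1
    · exact ihr hT (by simpa [hk] using hF) h.2

/-- Refutes the facets `2345`, `3456`, `2457`. -/
def ridgeEndsRefutation : Refutation :=
  .split 53 (.three 52 0 3 7) (.split 54 (.three 52 1 3 7) (.split 116 (.three 52 3 6 7) (.split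
  57 (.three 56 0 2 6) (.split 58 (.three 56 1 2 6) (.split 184 (.three 56 2 6 7) (.split 114
  (.split 178 (.edge 50 6 7) (.split 51 (.split 113 (.three 112 0 1 3) (.split 177 (.split 149
  (.split 85 (.edge 21 6 7) (.split 147 (.three 145 1 2 5) (.split 153 (.three 145 2 3 5) (.split
  150 (.three 148 0 1 5) (.split 154 (.one 146 3) (.split 156 (.three 148 0 3 5) (.split 165
  (.split 135 (.three 133 1 4 5) (.split 163 (.three 161 1 2 4) (.split 139 (.one 131 3) (.split
  166 (.three 164 0 1 4) (.split 142 (.one 134 3) (.split 170 (.one 138 5) (.edge 49 1 7)))))))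
  (.split 108 (.split 45 (.three 44 0 4 6) (.split 46 (.three 44 1 4 6) (.split 172 (.three 44 4 6
  7) (.split 166 (.split 102 (.edge 38 6 7) (.split 39 (.split 99 (.three 35 2 4 6) (.split 101
  (.split 105 (.three 104 0 2 4) (.one 97 2)) (.one 37 1))) (.one 38 7))) (.one 164 4))))) (.split
  106 (.split 170 (.edge 42 6 7) (.split 99 (.three 98 0 3 4) (.split 102 (.three 98 2 3 4)
  (.split 101 (.one 100 0) (.split 105 (.one 97 3) (.split 39 (.split 43 (.three 35 2 3 4) (.split
  45 (.split 46 (.three 44 0 1 4) (.one 42 6)) (.one 37 1))) (.split 45 (.one 37 3) (.split 142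
  (.split 78 (.edge 14 6 7) (.split 139 (.split 75 (.edge 11 6 7) (.split 90 (.split 83 (.three 82
  0 3 5) (.split 71 (.one 67 2) (.split 77 (.one 69 3) (.split 89 (.one 73 4) (.edge 50 0 6)))))
  (.one 74 5))) (.one 138 2))) (.split 139 (.one 138 0) (.split 135 (.split 163 (.split 43 (.three
  35 3 4 7) (.split 141 (.three 133 1 3 4) (.split 169 (.one 41 7) (.split 166 (.split 46 (.split
  172 (.three 44 1 4 7) (.edge 38 3 7)) (.one 38 7)) (.one 134 0))))) (.one 131 2)) (.split 163
  (.one 131 5) (.split 43 (.split 169 (.split 166 (.one 134 5) (.edge 41 1 7)) (.one 41 1)) (.one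
  35 4))))))))))))) (.split 105 (.split 169 (.edge 41 6 7) (.split 163 (.split 39 (.three 35 2 4
  7) (.split 43 (.three 35 3 4 7) (.split 99 (.three 35 4 6 7) (.split 45 (.split 102 (.split 166
  (.edge 38 6 7) (.split 46 (.three 44 0 1 4) (.one 38 6))) (.one 98 4)) (.one 41 6))))) (.one 161
  4))) (.one 104 4))))))))))) (.split 92 (.split 29 (.three 28 0 5 6) (.split 30 (.three 28 1 5 6)
  (.split 156 (.three 28 5 6 7) (.split 150 (.split 86 (.edge 22 6 7) (.split 23 (.split 83
  (.three 19 2 5 6) (.split 85 (.split 89 (.three 88 0 2 5) (.one 81 2)) (.one 21 1))) (.one 22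
  7))) (.one 148 5))))) (.split 90 (.split 83 (.three 82 0 3 5) (.split 86 (.three 82 2 3 5)
  (.split 85 (.one 84 0) (.split 89 (.one 81 3) (.split 106 (.split 75 (.three 74 0 4 5) (.split
  99 (.three 98 0 3 4) (.split 71 (.one 67 2) (.split 105 (.three 104 0 1 4) (.split 77 (.one 73
  2) (.split 101 (.one 69 5) (.edge 50 0 6))))))) (.split 172 (.split 45 (.three 44 0 4 7) (.split
  108 (.three 44 4 6 7) (.split 165 (.three 164 0 3 4) (.split 105 (.split 169 (.edge 41 6 7)
  (.split 43 (.split 163 (.three 35 3 4 7) (.one 161 4)) (.one 41 6))) (.one 104 4))))) (.split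
  165 (.split 101 (.edge 37 6 7) (.split 163 (.three 161 1 2 4) (.split 169 (.three 161 2 3 4)
  (.split 166 (.three 164 0 1 4) (.split 170 (.one 162 3) (.split 43 (.split 39 (.three 35 2 3 4)
  (.split 45 (.split 46 (.three 44 0 1 4) (.one 42 0)) (.one 37 7))) (.split 46 (.one 42 2)
  (.split 71 (.split 135 (.edge 7 6 7) (.split 77 (.split 141 (.edge 13 6 7) (.one 133 5)) (.one
  69 1))) (.split 77 (.one 69 3) (.split 75 (.split 99 (.split 39 (.three 35 2 4 6) (.split 45
  (.split 105 (.split 102 (.one 38 6) (.split 78 (.one 70 3) (.split 108 (.three 44 0 4 6) (.edge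
  41 2 6)))) (.one 41 2)) (.one 37 7))) (.one 67 3)) (.split 99 (.one 67 5) (.split 39 (.split 45
  (.three 37 1 3 7) (.split 105 (.one 41 6) (.edge 50 0 6))) (.one 35 4))))))))))))) (.split 166
  (.split 102 (.edge 38 6 7) (.split 99 (.split 39 (.three 35 2 4 6) (.split 43 (.three 35 3 4 6)
  (.split 163 (.three 35 4 6 7) (.split 169 (.split 105 (.edge 41 6 7) (.split 45 (.split 46
  (.three 44 0 1 4) (.one 38 7)) (.one 41 7))) (.one 161 4))))) (.one 98 4))) (.one 164 4)))))))))
  (.split 89 (.split 153 (.edge 25 6 7) (.split 147 (.split 23 (.three 19 2 5 7) (.split 27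
  (.three 19 3 5 7) (.split 83 (.three 19 5 6 7) (.split 29 (.split 86 (.split 150 (.edge 22 6 7)
  (.split 30 (.three 28 0 1 5) (.one 22 6))) (.one 82 5)) (.one 25 6))))) (.one 145 5))) (.one 88
  5))))) (.one 49 1))) (.one 50 6))) (.split 113 (.split 177 (.edge 49 6 7) (.split 51 (.split 178
  (.split 89 (.split 153 (.edge 25 6 7) (.split 83 (.three 81 1 3 5) (.split 85 (.three 81 2 3 5)
  (.split 90 (.three 88 0 1 5) (.split 86 (.one 82 2) (.split 92 (.one 84 3) (.split 105 (.split
  75 (.three 73 1 4 5) (.split 99 (.three 97 1 3 4) (.split 71 (.one 67 2) (.split 106 (.three 104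
  0 1 4) (.split 78 (.one 74 2) (.split 102 (.one 70 5) (.edge 49 1 6))))))) (.split 172 (.split
  46 (.three 44 1 4 7) (.split 108 (.three 44 4 6 7) (.split 166 (.three 164 1 3 4) (.split 106
  (.split 170 (.edge 42 6 7) (.split 43 (.split 163 (.three 35 3 4 7) (.one 162 4)) (.one 42 6)))
  (.one 104 4))))) (.split 166 (.split 102 (.edge 38 6 7) (.split 163 (.three 162 0 2 4) (.split
  170 (.three 162 2 3 4) (.split 165 (.three 164 0 1 4) (.split 169 (.one 161 3) (.split 43
  (.split 39 (.three 35 2 3 4) (.split 45 (.split 46 (.three 44 0 1 4) (.one 38 7)) (.one 41 1)))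
  (.split 45 (.one 41 2) (.split 71 (.split 135 (.edge 7 6 7) (.split 78 (.split 142 (.edge 14 6
  7) (.split 150 (.split 147 (.three 146 0 2 5) (.split 139 (.one 131 3) (.split 141 (.one 137 2)
  (.split 149 (.one 133 4) (.edge 50 0 7))))) (.one 134 5))) (.one 70 0))) (.split 78 (.one 70 3)
  (.split 75 (.split 99 (.split 39 (.three 35 2 4 6) (.split 101 (.one 37 6) (.split 77 (.one 69
  3) (.split 46 (.split 106 (.split 108 (.three 44 1 4 6) (.edge 42 2 6)) (.one 42 2)) (.one 38
  7))))) (.one 67 3)) (.split 99 (.one 67 5) (.split 39 (.split 101 (.split 106 (.one 74 5) (.edge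
  37 1 6)) (.one 37 1)) (.one 35 4))))))))))))) (.split 165 (.split 101 (.edge 37 6 7) (.split 99
  (.split 39 (.three 35 2 4 6) (.split 43 (.three 35 3 4 6) (.split 163 (.three 35 4 6 7) (.split
  45 (.split 170 (.split 106 (.edge 42 6 7) (.split 46 (.three 44 0 1 4) (.one 42 7))) (.one 162
  4)) (.one 37 7))))) (.one 97 4))) (.one 164 4))))))))))) (.split 156 (.split 30 (.three 28 1 5
  7) (.split 92 (.three 28 5 6 7) (.split 150 (.three 148 1 3 5) (.split 90 (.split 154 (.edge 26
  6 7) (.split 27 (.split 147 (.three 19 3 5 7) (.one 146 5)) (.one 26 6))) (.one 88 5)))))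
  (.split 150 (.split 86 (.edge 22 6 7) (.split 147 (.three 146 0 2 5) (.split 154 (.three 146 2 3
  5) (.split 149 (.three 148 0 1 5) (.split 153 (.one 145 3) (.split 27 (.split 23 (.three 19 2 3
  5) (.split 29 (.split 30 (.three 28 0 1 5) (.one 22 7)) (.one 25 1))) (.split 29 (.one 25 2)
  (.split 166 (.split 135 (.three 134 0 4 5) (.split 163 (.three 162 0 2 4) (.split 139 (.one 131
  3) (.split 165 (.three 164 0 1 4) (.split 141 (.one 133 3) (.split 169 (.one 137 5) (.edge 50 0
  7))))))) (.split 108 (.split 45 (.three 44 0 4 6) (.split 172 (.three 44 4 6 7) (.split 165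
  (.split 101 (.edge 37 6 7) (.split 39 (.split 99 (.three 35 2 4 6) (.split 105 (.three 104 0 2
  4) (.one 97 4))) (.one 37 7))) (.one 164 4)))) (.split 105 (.split 99 (.three 97 1 3 4) (.split
  101 (.three 97 2 3 4) (.split 102 (.one 100 1) (.split 106 (.one 98 3) (.split 71 (.split 135
  (.edge 7 6 7) (.split 78 (.split 142 (.edge 14 6 7) (.one 134 4)) (.one 70 0))) (.split 78 (.one
  70 3) (.split 75 (.split 83 (.split 23 (.three 19 2 5 6) (.split 85 (.one 21 6) (.split 77 (.one
  69 3) (.split 30 (.split 90 (.split 92 (.three 28 1 5 6) (.edge 26 2 6)) (.one 26 2)) (.one 22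
  7))))) (.one 67 3)) (.split 83 (.one 67 4) (.split 23 (.split 85 (.split 90 (.one 74 4) (.edge
  21 1 6)) (.one 21 1)) (.one 19 5)))))))))) (.split 106 (.split 170 (.edge 42 6 7) (.split 163
  (.split 39 (.three 35 2 4 7) (.split 43 (.three 35 3 4 7) (.split 99 (.three 35 4 6 7) (.split
  101 (.split 165 (.edge 37 6 7) (.split 45 (.split 46 (.three 44 0 1 4) (.one 42 6)) (.one 37
  6))) (.one 97 4))))) (.one 162 4))) (.one 104 4)))))))))))) (.split 149 (.split 85 (.edge 21 6
  7) (.split 83 (.split 23 (.three 19 2 5 6) (.split 27 (.three 19 3 5 6) (.split 147 (.three 19 5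
  6 7) (.split 29 (.split 154 (.split 90 (.edge 26 6 7) (.split 30 (.three 28 0 1 5) (.one 26 7)))
  (.one 146 5)) (.one 21 7))))) (.one 81 5))) (.one 148 5))))) (.one 50 0)) (.one 49 6))) (.one
  112 3))))))))

lemma check_ridgeEndsRefutation : ridgeEndsRefutation.check [60, 120, 180] [] = true := by
  decide +kernel

/-- Refutes the facets `2345`, `3456`, `0245` together with the non-facets `0246`, `0256`,
`0456`, `2456`. -/
def interiorRefutation : Refutation :=
  .split 54 (.three 52 0 1 3) (.split 180 (.three 52 0 3 7) (.split 57 (.three 56 0 2 6) (.split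
  58 (.three 56 1 2 6) (.split 184 (.three 56 2 6 7) (.split 114 (.split 178 (.edge 50 6 7)
  (.split 51 (.split 177 (.three 49 1 2 7) (.split 108 (.split 45 (.three 44 0 4 6) (.split 46
  (.three 44 1 4 6) (.split 172 (.three 44 4 6 7) (.split 102 (.split 166 (.edge 38 6 7) (.split
  39 (.split 43 (.three 35 2 3 4) (.split 99 (.three 35 2 4 6) (.split 163 (.three 35 2 4 7)
  (.split 165 (.three 37 1 4 7) (.split 105 (.one 97 3) (.split 169 (.one 41 7) (.split 106
  (.three 98 2 3 4) (.split 170 (.one 42 7) (.split 135 (.edge 7 5 7) (.split 147 (.edge 19 5 7)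
  (.split 139 (.one 131 3) (.split 149 (.edge 21 5 7) (.split 141 (.one 133 3) (.split 153 (.one
  137 4) (.split 156 (.edge 28 5 7) (.split 142 (.one 140 1) (.split 150 (.one 134 4) (.split 154
  (.one 138 4) (.seven))))))))))))))))))) (.one 38 6))) (.one 100 3))))) (.split 102 (.one 100 1)
  (.split 99 (.split 39 (.three 35 2 4 6) (.split 43 (.three 35 3 4 6) (.split 163 (.three 35 4 6
  7) (.split 105 (.split 169 (.edge 41 6 7) (.split 45 (.split 165 (.three 37 3 4 7) (.split 106
  (.three 98 0 3 4) (.split 46 (.three 44 0 1 4) (.split 166 (.one 38 7) (.split 170 (.one 42 7)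
  (.split 172 (.three 44 0 4 7) (.split 147 (.edge 19 5 7) (.split 141 (.edge 13 5 7) (.split 149
  (.edge 21 5 7) (.split 135 (.one 133 1) (.split 139 (.one 131 3) (.split 153 (.one 137 4)
  (.split 156 (.edge 28 5 7) (.split 142 (.one 140 1) (.split 150 (.one 134 4) (.split 154 (.one
  138 4) (.seven))))))))))))))))) (.one 41 6))) (.one 97 1))))) (.split 105 (.one 97 3) (.split
  106 (.split 170 (.edge 42 6 7) (.split 92 (.split 29 (.three 28 0 5 6) (.split 30 (.three 28 1 5
  6) (.split 156 (.three 28 5 6 7) (.split 86 (.split 150 (.edge 22 6 7) (.split 23 (.split 27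
  (.three 19 2 3 5) (.split 83 (.three 19 2 5 6) (.split 147 (.three 19 2 5 7) (.split 149 (.three
  21 1 5 7) (.split 89 (.one 81 3) (.split 153 (.one 25 7) (.split 90 (.three 82 2 3 5) (.split
  154 (.one 26 7) (.split 135 (.edge 7 4 7) (.split 163 (.edge 35 4 7) (.split 139 (.one 131 3)
  (.split 165 (.edge 37 4 7) (.split 141 (.one 133 3) (.split 169 (.one 137 5) (.split 142 (.one
  138 2) (.split 166 (.one 134 5) (.split 172 (.edge 44 4 7) (.seven)))))))))))))))))) (.one 22
  6))) (.one 84 3))))) (.split 86 (.one 84 1) (.split 83 (.split 23 (.three 19 2 5 6) (.split 27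
  (.three 19 3 5 6) (.split 147 (.three 19 5 6 7) (.split 89 (.split 153 (.edge 25 6 7) (.split 29
  (.split 149 (.three 21 3 5 7) (.split 90 (.three 82 0 3 5) (.split 30 (.three 28 0 1 5) (.split
  150 (.one 22 7) (.split 154 (.one 26 7) (.split 156 (.three 28 0 5 7) (.split 163 (.edge 35 4 7)
  (.split 141 (.edge 13 4 7) (.split 165 (.edge 37 4 7) (.split 135 (.one 133 1) (.split 139 (.one
  131 3) (.split 169 (.one 137 5) (.split 142 (.one 138 2) (.split 166 (.one 134 5) (.split 172
  (.edge 44 4 7) (.seven)))))))))))))))) (.one 25 6))) (.one 81 1))))) (.split 89 (.one 81 3)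
  (.split 90 (.split 75 (.three 74 0 4 5) (.split 71 (.one 67 2) (.split 77 (.one 69 3) (.edge 50
  0 6)))) (.one 82 5))))))) (.one 98 4))))))) (.one 50 6))) (.one 112 3))))))

lemma check_interiorRefutation : interiorRefutation.check [60, 120, 53] [85, 101, 113, 116] = true := by
  decide +kernel

end Refutation

section Labelling

variable {α : Type*} [DecidableEq α] {K : Complex α} {w : ℕ → α}

/-- The set of labels of the vertices coded by the bit mask `k`. -/
def face (w : ℕ → α) (k : ℕ) : Finset α := ((Finset.range 8).filter (k.testBit ·)).image w

lemma mem_face {k : ℕ} {a : α} : a ∈ face w k ↔ ∃ i < 8, k.testBit i = true ∧ w i = a := by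
  simp [face, and_assoc]

lemma face_or {t x : ℕ} (hx : x < 8) : face w (t ||| 2 ^ x) = insert (w x) (face w t) := by
  ext a
  simp only [mem_face, Finset.mem_insert, Nat.testBit_or, Nat.testBit_two_pow, Bool.or_eq_true,
    decide_eq_true_eq]
  grind

lemma face_two_pow {x : ℕ} (hx : x < 8) : face w (2 ^ x) = {w x} := by
  have h0 : face w 0 = ∅ := by simp [face]
  rw [← Nat.zero_or (2 ^ x), face_or hx, h0, insert_empty_eq]

lemma notMem_face (hw : Set.InjOn w (Finset.range 8)) {t x : ℕ} (hx : x < 8)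
    (ht : t.testBit x = false) : w x ∉ face w t := by
  rw [mem_face]
  rintro ⟨i, hi, hit, hix⟩
  rw [hw (by simpa using hi) (by simpa using hx) hix, ht] at hit
  exact absurd hit (by simp)

/-- If no move adds the missing edge, two adjacent facets have adjacent apices. -/
lemma pair_mem_of_not_movable (hno : ∀ A u v, ¬ Movable K A u v) {σ : Finset α} {x y : α}
    (hx : x ∉ σ) (hy : y ∉ σ) (hxy : x ≠ y) (hxσ : insert x σ ∈ facets K 3)
    (hyσ : insert y σ ∈ facets K 3) : {x, y} ∈ K := by
  by_contra h
  exact hno σ x y ⟨hx, hy, hxy, hxσ, hyσ, h⟩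

lemma exists_lt_of_card_eq_two {s : Finset ℕ} (h : s.card = 2) : ∃ p q, p < q ∧ s = {p, q} := by
  obtain ⟨p, q, hpq, rfl⟩ := Finset.card_eq_two.1 h
  rcases hpq.lt_or_gt with h | h
  · exact ⟨p, q, h, rfl⟩
  · exact ⟨q, p, h, Finset.pair_comm p q⟩

/-- A facet is coded by a 4-element set of labels. -/
lemma exists_image_eq (hw : (Finset.range 8).image w = verts K)
    (h8 : (verts K).card = 8) {τ : Finset α} (hτ : τ ∈ facets K 3) :
    ∃ s ⊆ Finset.range 8, s.card = 4 ∧ s.image w = τ := by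
  have hsub : τ ⊆ (Finset.range 8).image w := fun x hx =>
    hw ▸ mem_verts.2 ⟨τ, (mem_facets.1 hτ).1, hx⟩
  have hinj : Set.InjOn w (Finset.range 8) :=
    Finset.card_image_iff.1 (by rw [hw, h8, Finset.card_range])
  obtain ⟨s, hs, rfl⟩ := Finset.subset_image_iff.1 hsub
  refine ⟨s, hs, ?_, rfl⟩
  rw [← Finset.card_image_of_injOn (hinj.mono hs), (mem_facets.1 hτ).2]

lemma WeakPM.stuck (hK : WeakPM K 3) (hw : (Finset.range 8).image w = verts K)
    (h8 : (verts K).card = 8) (hno : ∀ A u v, ¬ Movable K A u v) (huv : {w 6, w 7} ∉ K) :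
    Stuck fun k => face w k ∈ facets K 3 := by
  have hinj : Set.InjOn w (Finset.range 8) :=
    Finset.card_image_iff.1 (by rw [hw, h8, Finset.card_range])
  have hne : ∀ {x y : ℕ}, x < 8 → y < 8 → x ≠ y → w x ≠ w y := fun hx hy hxy h =>
    hxy (hinj (by simpa using hx) (by simpa using hy) h)
  constructor
  · intro t x y z hx hy hz htx hty htz hxy hxz hyz h1 h2 h3
    rw [face_or ‹_›] at h1 h2 h3
    exact hK.not_three three_ne_zero (notMem_face hinj hx htx) (notMem_face hinj hz htz)
      (hne hx hy hxy) (hne hx hz hxz) (hne hy hz hyz) h1 h2 h3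
  · intro t x hx htx h
    rw [face_or hx] at h
    obtain ⟨y, hy, hyx, hyt⟩ := hK.exists_other three_ne_zero (notMem_face hinj hx htx) h
    have hyV : y ∈ (Finset.range 8).image w :=
      hw ▸ mem_verts.2 ⟨_, (mem_facets.1 hyt).1, Finset.mem_insert_self _ _⟩
    obtain ⟨j, hj, rfl⟩ := Finset.mem_image.1 hyV
    rw [Finset.mem_range] at hj
    refine ⟨j, hj, ?_, fun h => hyx (h ▸ rfl), by rwa [face_or hj]⟩
    by_contra hjt
    exact hy (mem_face.2 ⟨j, hj, by simpa using hjt, rfl⟩)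
  · intro t x y hx hy htx hty hxy h1 h2
    rw [face_or ‹_›] at h1 h2
    have hmem := pair_mem_of_not_movable hno (notMem_face hinj hx htx) (notMem_face hinj hy hty)
      (hne hx hy hxy) h1 h2
    obtain ⟨τ, hτ, hsub⟩ := hK.exists_facet hmem
    obtain ⟨s, hs, hs4, rfl⟩ := exists_image_eq hw h8 hτ
    have hin : ∀ {x}, x < 8 → w x ∈ s.image w → x ∈ s := by
      intro x hx hxs
      obtain ⟨j, hj, hjx⟩ := Finset.mem_image.1 hxs
      rwa [← hinj (hs hj) (by simpa using hx) hjx]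
    have hxs := hin hx (hsub (by simp))
    have hys := hin hy (hsub (by simp))
    obtain ⟨p, q, hpq, hs'⟩ := exists_lt_of_card_eq_two (s := (s.erase x).erase y) (by
      rw [Finset.card_erase_of_mem (by grind), Finset.card_erase_of_mem hxs, hs4])
    have hp : p ∈ (s.erase x).erase y := by simp [hs']
    have hq : q ∈ (s.erase x).erase y := by simp [hs']
    simp only [Finset.mem_erase] at hp hq
    have hq8 : q < 8 := Finset.mem_range.1 (hs hq.2.2)
    refine ⟨q, hq8, p, hpq, hp.2.1, hp.1, hq.2.1, hq.1, ?_⟩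
    rw [face_or hq8, face_or (hpq.trans hq8), face_or hy, face_two_pow hx]
    have hs'' : insert x (insert y ((s.erase x).erase y)) = s := by
      rw [Finset.insert_erase (Finset.mem_erase.2 ⟨hxy.symm, hys⟩), Finset.insert_erase hxs]
    have : s = {q, p, y, x} := by
      rw [← hs'', hs']
      ext
      simp only [Finset.mem_insert, Finset.mem_singleton]
      tauto
    rw [this] at hτ
    simpa [Finset.image_insert] using hτ
  · intro k h6 h7 hk
    refine huv (hK.mem_of_subset (mem_facets.1 hk).1 ?_ (by simp))
    intro a ha
    rw [Finset.mem_insert, Finset.mem_singleton] at ha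
    rcases ha with rfl | rfl
    · exact mem_face.2 ⟨6, by simp, h6, rfl⟩
    · exact mem_face.2 ⟨7, by simp, h7, rfl⟩
  · obtain ⟨τ, hτ, hsub⟩ := hK.exists_facet (hK.singleton_mem
      (hw ▸ Finset.mem_image_of_mem w (show 7 ∈ Finset.range 8 by simp)))
    obtain ⟨s, hs, hs4, rfl⟩ := exists_image_eq hw h8 hτ
    have h7 : 7 ∈ s := by
      obtain ⟨j, hj, hjx⟩ := Finset.mem_image.1 (hsub (Finset.mem_singleton_self _))
      rwa [← hinj (hs hj) (by simp) hjx]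
    have hs3 : (s.erase 7).card = 3 := by rw [Finset.card_erase_of_mem h7, hs4]
    set r := (s.erase 7).max' (Finset.card_pos.1 (by omega)) with hr
    have hrmem : r ∈ s.erase 7 := Finset.max'_mem _ _
    obtain ⟨p, q, hpq, hs'⟩ := exists_lt_of_card_eq_two (s := (s.erase 7).erase r) (by
      rw [Finset.card_erase_of_mem hrmem, hs3])
    have hq : q ∈ (s.erase 7).erase r := by simp [hs']
    have hqr : q < r := lt_of_le_of_ne (Finset.le_max' _ _ (Finset.mem_of_mem_erase hq))
      (Finset.ne_of_mem_erase hq)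
    have hr8 : r < 8 := Finset.mem_range.1 (hs (Finset.mem_of_mem_erase hrmem))
    have hr7 : r < 7 := by
      have := Finset.ne_of_mem_erase hrmem
      omega
    refine ⟨r, hr7, q, hqr, p, hpq, ?_⟩
    rw [face_or hr8, face_or (hqr.trans hr8), face_or ((hpq.trans hqr).trans hr8),
      face_two_pow (by simp)]
    have hs'' : insert 7 (insert r ((s.erase 7).erase r)) = s := by
      rw [Finset.insert_erase hrmem, Finset.insert_erase h7]
    have : s = {r, q, p, 7} := by
      rw [← hs'', hs']
      ext
      simp only [Finset.mem_insert, Finset.mem_singleton]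
      tauto
    rw [this] at hτ
    simpa [Finset.image_insert] using hτ

end Labelling

section Neighbourly

variable {α : Type*} [DecidableEq α] {K : Complex α}

/-- Labels `0, …, 7` for eight vertices. -/
def label (a b c d e f g h : α) : ℕ → α
  | 0 => a
  | 1 => b
  | 2 => c
  | 3 => d
  | 4 => e
  | 5 => f
  | 6 => g
  | _ => h

lemma image_label (a b c d e f g h : α) :
    (Finset.range 8).image (label a b c d e f g h) = {a, b, c, d, e, f, g, h} := by
  have : Finset.range 8 = {0, 1, 2, 3, 4, 5, 6, 7} := by decide
  simp [this, Finset.image_insert, label]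

lemma face_eq {w : ℕ → α} {k : ℕ} (s : Finset ℕ)
    (hs : (Finset.range 8).filter (k.testBit ·) = s) : face w k = s.image w := by
  rw [← hs, face]

lemma exists_step {β : Type*} {r : β → β → Prop} {p : β → Prop} {a b : β}
    (h : Relation.ReflTransGen r a b) (ha : p a) (hb : ¬ p b) : ∃ x y, r x y ∧ p x ∧ ¬ p y := by
  induction h with
  | refl => exact absurd ha hb
  | @tail x y _ hxy ih =>
    by_cases hx : p x
    · exact ⟨x, y, hxy, hx, hb⟩
    · exact ih hx

lemma WeakPM.not_ridgeEnds (hK : WeakPM K 3) (h8 : (verts K).card = 8)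
    (hno : ∀ A u v, ¬ Movable K A u v) {a b c d e f u v : α}
    (hV : verts K = {a, b, c, d, e, f, u, v}) (huv : {u, v} ∉ K) (h1 : {c, d, e, f} ∈ facets K 3)
    (h2 : {d, e, f, u} ∈ facets K 3) (h3 : {c, e, f, v} ∈ facets K 3) : False := by
  have hS := hK.stuck (w := label a b c d e f u v) ((image_label ..).trans hV.symm) h8 hno huv
  refine hS.false_of_check _ ?_ (by simp) check_ridgeEndsRefutation
  simp only [List.forall_mem_cons]
  rw [face_eq {2, 3, 4, 5} (by decide), face_eq {3, 4, 5, 6} (by decide),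
    face_eq {2, 4, 5, 7} (by decide)]
  simpa [Finset.image_insert, label] using ⟨h1, h2, h3⟩

lemma WeakPM.not_interior (hK : WeakPM K 3) (h8 : (verts K).card = 8)
    (hno : ∀ A u v, ¬ Movable K A u v) {a b c d e f u v : α}
    (hV : verts K = {a, b, c, d, e, f, u, v}) (huv : {u, v} ∉ K) (h1 : {c, d, e, f} ∈ facets K 3)
    (h2 : {d, e, f, u} ∈ facets K 3) (h3 : {a, c, e, f} ∈ facets K 3)
    (h4 : {a, c, e, u} ∉ facets K 3) (h5 : {a, c, f, u} ∉ facets K 3)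
    (h6 : {a, e, f, u} ∉ facets K 3) (h7 : {c, e, f, u} ∉ facets K 3) : False := by
  have hS := hK.stuck (w := label a b c d e f u v) ((image_label ..).trans hV.symm) h8 hno huv
  refine hS.false_of_check _ ?_ ?_ check_interiorRefutation
  · simp only [List.forall_mem_cons]
    rw [face_eq {2, 3, 4, 5} (by decide), face_eq {3, 4, 5, 6} (by decide),
      face_eq {0, 2, 4, 5} (by decide)]
    simpa [Finset.image_insert, label] using ⟨h1, h2, h3⟩
  · simp only [List.forall_mem_cons]
    rw [face_eq {0, 2, 4, 6} (by decide), face_eq {0, 2, 5, 6} (by decide),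
      face_eq {0, 4, 5, 6} (by decide), face_eq {2, 4, 5, 6} (by decide)]
    simpa [Finset.image_insert, label] using ⟨h4, h5, h6, h7⟩

lemma rotate_four (a b c d : α) : ({a, b, c, d} : Finset α) = {d, a, b, c} := by
  ext
  simp only [Finset.mem_insert, Finset.mem_singleton]
  tauto

lemma rotate_six (a b c d e f : α) : ({a, b, c, d, e, f} : Finset α) = {e, f, b, a, c, d} := by
  ext
  simp only [Finset.mem_insert, Finset.mem_singleton]
  tauto

/-- A facet `σ` with two distinct ridges `σ ∖ {x}` and `σ ∖ {c}` has four vertices `c, x, p, q`. -/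
lemma exists_two_ridges {t t₀ : Finset α} {x : α} (ht : t.card = 3)
    (ht₀ : t₀.card = 3) (hsub : t₀ ⊆ insert x t) (hne : t₀ ≠ t) :
    ∃ c p q, t = {c, p, q} ∧ t₀ = {x, p, q} := by
  have hxt₀ : x ∈ t₀ := by
    by_contra h
    refine hne (Finset.eq_of_subset_of_card_le (fun y hy => ?_) (by omega))
    exact Finset.mem_of_mem_insert_of_ne (hsub hy) (fun hyx => h (hyx ▸ hy))
  obtain ⟨p, q, -, hpq⟩ := Finset.card_eq_two.1
    (show (t₀.erase x).card = 2 by rw [Finset.card_erase_of_mem hxt₀, ht₀])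
  have hst : t₀.erase x ⊆ t := fun y hy =>
    Finset.mem_of_mem_insert_of_ne (hsub (Finset.mem_of_mem_erase hy)) (Finset.ne_of_mem_erase hy)
  obtain ⟨c, -, hc⟩ := exists_insert_eq hst (by rw [Finset.card_erase_of_mem hxt₀, ht, ht₀])
  refine ⟨c, p, q, by rw [← hc, hpq], by rw [← hpq, Finset.insert_erase hxt₀]⟩

/-- An 8-vertex 3-pseudomanifold to which no bistellar 1-move applies is neighbourly. -/
lemma IsPM.neighbourly (hK : IsPM K 3) (h8 : (verts K).card = 8)
    (hno : ∀ A u v, ¬ Movable K A u v) : Neighbourly K := by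
  intro u hu v hv huv
  by_contra hedge
  have hW := hK.1
  have hsep : ∀ σ ∈ facets K 3, u ∈ σ → v ∉ σ := fun σ hσ hu hv =>
    hedge (hW.mem_of_subset (mem_facets.1 hσ).1 (by simp [Finset.insert_subset_iff, hu, hv])
      (by simp))
  obtain ⟨σ₀, hσ₀, huσ₀⟩ := hW.exists_facet (hW.singleton_mem hu)
  obtain ⟨τ₀, hτ₀, hvτ₀⟩ := hW.exists_facet (hW.singleton_mem hv)
  rw [Finset.singleton_subset_iff] at huσ₀ hvτ₀
  obtain ⟨σ, σ', ⟨hσ, hσ', hcard⟩, hp, hp'⟩ := exists_step (hK.2 σ₀ hσ₀ τ₀ hτ₀)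
    (p := fun σ => u ∈ σ ∨ (v ∉ σ ∧ ∃ t ⊆ σ, t.card = 3 ∧ insert u t ∈ facets K 3)) (.inl huσ₀)
    (by
      rintro (h | h)
      · exact hsep τ₀ hτ₀ h hvτ₀
      · exact h.1 hvτ₀)
  rw [not_or, not_and, not_exists] at hp'
  obtain ⟨huσ', hp'⟩ := hp'
  obtain ⟨x, hx, hxσ⟩ := exists_insert_eq (Finset.inter_subset_left (s₁ := σ) (s₂ := σ'))
    (by rw [(mem_facets.1 hσ).2, hcard])
  obtain ⟨y, hy, hyσ⟩ := exists_insert_eq (Finset.inter_subset_right (s₁ := σ) (s₂ := σ'))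
    (by rw [(mem_facets.1 hσ').2, hcard])
  have htσ : σ ∩ σ' ⊆ σ := Finset.inter_subset_left
  have htσ' : σ ∩ σ' ⊆ σ' := Finset.inter_subset_right
  set t := σ ∩ σ' with ht
  have hut : u ∉ t := fun h => huσ' (htσ' h)
  have hnut : insert u t ∉ facets K 3 := by
    intro hutF
    by_cases hvσ' : v ∈ σ'
    · have hvt : v ∉ t := fun h => hsep _ hutF (by simp) (by simp [h])
      have hvy : v = y := by
        rw [← hyσ, Finset.mem_insert] at hvσ'
        exact hvσ'.resolve_right hvt
      rw [← hyσ, ← hvy] at hσ'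
      exact hedge (pair_mem_of_not_movable hno hut hvt huv hutF hσ')
    · exact hp' hvσ' t ⟨htσ', hcard, hutF⟩
  have huσ : u ∉ σ := by
    intro h
    rw [← hxσ, Finset.mem_insert] at h
    rcases h with h | h
    · exact hnut (by rwa [h, hxσ])
    · exact hut h
  obtain ⟨hvσ, t₀, ht₀, hct₀, hut₀⟩ := hp.resolve_left huσ
  have hne : t₀ ≠ t := by
    rintro rfl
    exact hnut hut₀
  obtain ⟨c, p, q, htc, htx⟩ := exists_two_ridges hcard hct₀ (hxσ ▸ ht₀) hne
  have hFV : ∀ {τ}, τ ∈ facets K 3 → τ ⊆ verts K := fun hτ a ha =>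
    mem_verts.2 ⟨_, (mem_facets.1 hτ).1, ha⟩
  have heq : ({c, x, p, q, u, v} : Finset α) = insert u (insert v σ) := by
    rw [← hxσ, htc, rotate_six]
  have hsix : ({c, x, p, q, u, v} : Finset α) ⊆ verts K :=
    heq ▸ Finset.insert_subset hu (Finset.insert_subset hv (hFV hσ))
  have hsix6 : ({c, x, p, q, u, v} : Finset α).card = 6 := by
    rw [heq, Finset.card_insert_of_notMem (by simp [huv, huσ]),
      Finset.card_insert_of_notMem hvσ, (mem_facets.1 hσ).2]
  have h1 : {c, x, p, q} ∈ facets K 3 := by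
    rwa [Finset.insert_comm, ← htc, hxσ]
  have h2 : {x, p, q, u} ∈ facets K 3 := by
    rwa [htx, ← rotate_four] at hut₀
  have hyσ' : σ' = {y, c, p, q} := by rw [← hyσ, htc]
  by_cases hvσ' : v ∈ σ'
  · have hvy : v = y := by
      rw [← hyσ, Finset.mem_insert] at hvσ'
      exact hvσ'.resolve_right fun h => hvσ (htσ h)
    obtain ⟨a, b, -, hab⟩ := Finset.card_eq_two.1
      (show (verts K \ {c, x, p, q, u, v}).card = 2 by
        rw [Finset.card_sdiff_of_subset hsix, hsix6, h8])
    refine hW.not_ridgeEnds h8 hno (a := a) (b := b) (c := c) (d := x) (e := p) (f := q) ?_ hedge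
      h1 h2 ?_
    · rw [← Finset.sdiff_union_of_subset hsix, hab, Finset.insert_union, ← Finset.insert_eq]
    · rwa [hyσ', ← hvy, ← rotate_four] at hσ'
  · have hyn : y ∉ ({c, x, p, q, u, v} : Finset α) := by
      have hyσ'' : y ∈ σ' := hyσ ▸ Finset.mem_insert_self y t
      rw [heq, Finset.mem_insert, Finset.mem_insert]
      rintro (rfl | rfl | h)
      · exact huσ' hyσ''
      · exact hvσ' hyσ''
      · exact hy (Finset.mem_inter.2 ⟨h, hyσ''⟩)
    have hyV : insert y {c, x, p, q, u, v} ⊆ verts K :=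
      Finset.insert_subset (hFV hσ' (by simp [hyσ'])) hsix
    obtain ⟨b, hb⟩ := Finset.card_eq_one.1
      (show (verts K \ insert y {c, x, p, q, u, v}).card = 1 by
        rw [Finset.card_sdiff_of_subset hyV, Finset.card_insert_of_notMem hyn, hsix6, h8])
    have hnot : ∀ i ∈ σ', ∀ j ∈ σ', ∀ k ∈ σ', {i, j, k, u} ∉ facets K 3 := by
      intro i hi j hj k hk h
      rw [rotate_four] at h
      have h4 := (mem_facets.1 h).2
      have h3 := Finset.card_insert_le u {i, j, k}
      have h3' := Finset.card_le_three (a := i) (b := j) (c := k)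
      exact hp' hvσ' _ ⟨by simp [Finset.insert_subset_iff, hi, hj, hk], by omega, h⟩
    refine hW.not_interior h8 hno (a := y) (b := b) (c := c) (d := x) (e := p) (f := q) ?_ hedge
      h1 h2 (hyσ' ▸ hσ') ?_ ?_ ?_ ?_
    · rw [← Finset.sdiff_union_of_subset hyV, hb, ← Finset.insert_eq, Finset.insert_comm]
    all_goals exact hnot _ (by simp [hyσ']) _ (by simp [hyσ']) _ (by simp [hyσ'])

end Neighbourly

section Main

variable {α : Type*} [DecidableEq α] {K : Complex α}

/-- The pairs of vertices that are not edges. -/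
def nonEdges (K : Complex α) : Finset (Finset α) := ((verts K).powersetCard 2).filter (· ∉ K)

lemma Movable.card_nonEdges_move_lt {A : Finset α} {u v : α} (h : Movable K A u v)
    (hK : WeakPM K 3) : (nonEdges (move K A u v)).card < (nonEdges K).card := by
  refine Finset.card_lt_card ((Finset.ssubset_iff_of_subset fun e he => ?_).2 ⟨{u, v}, ?_, ?_⟩)
  · simp only [nonEdges, Finset.mem_filter, Finset.mem_powersetCard, h.verts_move hK] at he ⊢
    exact ⟨he.1, fun heK => he.2 (h.mem_move_of_card_le hK heK he.1.2.le)⟩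
  · have hu : u ∈ verts K := mem_verts.2 ⟨_, (mem_facets.1 h.left_mem).1, by simp⟩
    have hv : v ∈ verts K := mem_verts.2 ⟨_, (mem_facets.1 h.right_mem).1, by simp⟩
    simp [nonEdges, Finset.mem_powersetCard, Finset.insert_subset_iff, hu, hv,
      Finset.card_pair h.ne, h.edge_notMem]
  · simp [nonEdges, h.edge_mem_move]

/-- Greedily applying bistellar 1-moves ends at a complex to which no such move applies. -/
lemma IsPM.exists_reflTransGen_not_movable (hK : IsPM K 3) :
    ∃ L : Complex α, Relation.ReflTransGen (BMove 3 1) K L ∧ IsPM L 3 ∧ verts L = verts K ∧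
      ∀ A u v, ¬ Movable L A u v := by
  induction hn : (nonEdges K).card using Nat.strong_induction_on generalizing K with
  | _ n ih =>
    by_cases hno : ∀ A u v, ¬ Movable K A u v
    · exact ⟨K, .refl, hK, rfl, hno⟩
    · push Not at hno
      obtain ⟨A, u, v, h⟩ := hno
      obtain ⟨L, hL, hPM, hV, hL'⟩ :=
        ih _ (hn ▸ h.card_nonEdges_move_lt hK.1) (h.isPM_move hK) rfl
      exact ⟨L, .head (h.bMove hK.1) hL, hPM, hV.trans (h.verts_move hK.1), hL'⟩

end Main

end NPM

/-- every `8`-vertex `3`-pseudomanifold can be carried, by a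
finite sequence of bistellar 1-moves, to a neighbourly `3`-pseudomanifold on
the same `8` vertices. -/
theorem statement0 {α : Type u} [DecidableEq α] (M : NPM.Complex α)
    (hM : NPM.IsPM M 3) (h8 : (NPM.verts M).card = 8) :
    ∃ N : NPM.Complex α,
      Relation.ReflTransGen (NPM.BMove 3 1) M N ∧
      NPM.IsPM N 3 ∧ NPM.Neighbourly N ∧ NPM.verts N = NPM.verts M := by
  obtain ⟨N, hN, hPM, hV, hno⟩ := hM.exists_reflTransGen_not_movable
  exact ⟨N, hN, hPM, hPM.neighbourly (hV ▸ h8) hno, hV⟩
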